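/- Let P' be a plan containing a time-stamped macro-action (t0, a0) with a0 = a1 ⊕ a2 defined. Then δ_{P'}(t0, a0) > 0, and there exist real numbers t1, t2 with t0 − δ_{P'}(t0, a0) < t1 < t0 and t1 + dur(a1) < t2 < t0 + dur(a1) such that P = {(t1, a1), (t2, a2)} ∪ P' ∖ {(t0, a0)} is a plan, i.e., for any two distinct time-stamped actions (s1, b1), (s2, b2) ∈ P: s1 ≠ s2, s1 + dur(b1) ≠ s2, and s1 + dur(b1) ≠ s2 + dur(b2). -/

import Mathlib

open Set

/-- A durative action over atoms of type `α`:
duration, preconditions at start / as invariant / at end,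
and positive/negative effects at start and end. -/
structure DAction (α : Type*) where
  dur : ℝ
  preS : Set α
  preInv : Set α
  preE : Set α
  effSp : Set α
  effSm : Set α
  effEp : Set α
  effEm : Set α

namespace DAction

/-- Well-formedness of a durative action. -/
def WF {α : Type*} (a : DAction α) : Prop :=
  0 < a.dur ∧ a.effSm ∩ (a.effSp ∪ a.preInv) = ∅ ∧ a.effEm ∩ a.effEp = ∅

/-- All atoms of an action belong to `V`. -/
def Over {α : Type*} (a : DAction α) (V : Set α) : Prop :=
  a.preS ⊆ V ∧ a.preInv ⊆ V ∧ a.preE ⊆ V ∧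
  a.effSp ⊆ V ∧ a.effSm ⊆ V ∧ a.effEp ⊆ V ∧ a.effEm ⊆ V

end DAction

/-- A scheduled effect `(t, preInv, preE, effEp, effEm)`,
recording the end time, invariant, end precondition and end effects
of an action that has started but not yet ended. -/
abbrev Sched (α : Type*) := ℝ × Set α × Set α × Set α × Set α

/-- The scheduled effect added when action `a` starts at time `t`. -/
def schedOf {α : Type*} (t : ℝ) (a : DAction α) : Sched α :=
  (t + a.dur, a.preInv, a.preE, a.effEp, a.effEm)

/-- The tuple identifying an ending event of action `a` at time `t`. -/
def endTuple {α : Type*} (t : ℝ) (a : DAction α) : Sched α :=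
  (t, a.preInv, a.preE, a.effEp, a.effEm)

/-- A time-stamped state `(t, s, E)`. -/
abbrev TState (α : Type*) := ℝ × Set α × Set (Sched α)

section Plans

variable {α β : Type*}

/-- `P` is a (valid) plan, where the elements of `β` labelling time stamps are
interpreted as durative actions via `f`: finitely many time-stamped actions with
positive starting times and mutually disjoint starting and ending times. -/
def IsPlan (f : β → DAction α) (P : Set (ℝ × β)) : Prop :=
  P.Finite ∧ (∀ p ∈ P, 0 < p.1) ∧
  ∀ p ∈ P, ∀ q ∈ P, p ≠ q →
    p.1 ≠ q.1 ∧ p.1 + (f p.2).dur ≠ q.1 ∧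
    p.1 + (f p.2).dur ≠ q.1 + (f q.2).dur

/-- Candidate time stamps for the next event after state `st`. -/
def candTimes (f : β → DAction α) (P : Set (ℝ × β)) (st : TState α) : Set ℝ :=
  {t | ∃ b, (t, b) ∈ P ∧ st.1 < t} ∪ {t | ∃ e ∈ st.2.2, e.1 = t}

/-- One construction step of the induced sequence of time-stamped states
at position `i ≥ 1`: the new time stamp is the least candidate time, and the
state and scheduled effects are updated according to a starting or ending event. -/
def StepAt (f : β → DAction α) (P : Set (ℝ × β)) (σ : ℕ → TState α) (i : ℕ) : Prop :=
  ((σ i).1 ∈ candTimes f P (σ (i - 1)) ∧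
    ∀ t ∈ candTimes f P (σ (i - 1)), (σ i).1 ≤ t) ∧
  ((∃ b, ((σ i).1, b) ∈ P ∧
      (σ i).2.1 = (f b).effSp ∪ ((σ (i - 1)).2.1 \ (f b).effSm) ∧
      (σ i).2.2 = insert (schedOf (σ i).1 (f b)) (σ (i - 1)).2.2) ∨
   (∃ e ∈ (σ (i - 1)).2.2, e.1 = (σ i).1 ∧
      (σ i).2.1 = e.2.2.2.1 ∪ ((σ (i - 1)).2.1 \ e.2.2.2.2) ∧
      (σ i).2.2 = (σ (i - 1)).2.2 \ {e}))

/-- `σ` is the sequence of `2|P|+1` time-stamped states induced by plan `P`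
with initial state `s0`. -/
def InducedSeq (f : β → DAction α) (P : Set (ℝ × β)) (s0 : Set α)
    (σ : ℕ → TState α) : Prop :=
  σ 0 = (0, s0, ∅) ∧ ∀ i, 1 ≤ i → i ≤ 2 * P.ncard → StepAt f P σ i

/-- Consistency of a plan `P` with induced sequence `σ`: invariants of all
scheduled effects hold, and start/end preconditions hold at the
corresponding events. -/
def Consistent (f : β → DAction α) (P : Set (ℝ × β)) (σ : ℕ → TState α) : Prop :=
  ∀ i, 1 ≤ i → i ≤ 2 * P.ncard →
    (∀ e ∈ (σ i).2.2, e.2.1 ⊆ (σ i).2.1) ∧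
    (∀ b, ((σ i).1, b) ∈ P → (f b).preS ⊆ (σ (i - 1)).2.1) ∧
    (∀ e ∈ (σ (i - 1)).2.2, e.1 = (σ i).1 → e.2.2.1 ⊆ (σ (i - 1)).2.1)

end Plans

section Macro

variable {α : Type*}

/-- The macro-action `a1 ⊕ a2` of Definition 1. -/
def macroComp (a1 a2 : DAction α) : DAction α where
  dur := a1.dur + a2.dur
  preS := a1.preS ∪ (((a1.preInv ∪ a1.preE) ∩ (a1.effEm ∪ a2.effSm)) \ a1.effSp) ∪
    ((a2.preS ∩ a2.effSm) \ (a1.effSp ∪ a1.effEp))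
  preInv := ((a1.preInv ∪ a1.preE) \ ((a1.effEm ∪ a2.effSm) \ a1.effSm)) ∪
    (a2.preS \ (a1.effEp ∪ (a2.effSm \ (a1.effSm ∪ a1.effEm)))) ∪
    (a2.preInv \ (a1.effEp ∪ a2.effSp))
  preE := a2.preE \ (a1.effEp ∪ a2.effSp)
  effSp := a1.effSp \ (a1.effEm ∪ a2.effSm)
  effSm := a1.effSm ∪ (a1.effEm ∪ a2.effSm)
  effEp := a2.effEp ∪ ((a1.effEp ∪ a2.effSp) \ (a2.effSm ∪ a2.effEm))
  effEm := a2.effEm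

/-- The provisos under which the composition `a1 ⊕ a2` is defined. -/
def MacroDefined (a1 a2 : DAction α) : Prop :=
  (macroComp a1 a2).effSm ∩ (macroComp a1 a2).preInv = ∅ ∧
  (a2.preE ∩ (a1.effEm ∪ a2.effSm)) \ a2.effSp = ∅

/-- Mutex atoms: `(true, v)` represents `x(v)` and `(false, v)` represents `x(¬v)`. -/
abbrev Mux (α : Type*) := Bool × α

/-- The mutex atoms contributed by composing `a1` and `a2`,
given the mutex atoms `aux2` of `a2`. -/
def auxComp (a1 a2 : DAction α) (aux2 : Set (Mux α)) : Set (Mux α) :=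
  {m | m.1 = false ∧ m.2 ∈
      ((((a1.effEp ∪ a2.effSp) \ (a2.effEp ∪ (a2.effSm ∪ a2.effEm))) ∪
        ((a1.preInv ∪ a1.preE) ∩ (a1.effEm ∪ a2.effSm)) ∪
        ((a2.preS ∩ a2.effSm) \ a1.effEp) ∪
        ((a2.preInv ∪ a2.preE) ∩ (a1.effEp ∪ a2.effSp))) \
        (macroComp a1 a2).preInv)} ∪
  {m | m.1 = true ∧ m.2 ∈ a1.effEm ∪ a2.effSm} ∪ aux2

/-- Action terms: either an ordinary durative action, or a (right-associatively
chained) composition of two action terms into a macro-action. -/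
inductive ActTerm (α : Type*) where
  | prim : DAction α → ActTerm α
  | comp : ActTerm α → ActTerm α → ActTerm α

namespace ActTerm

/-- The durative action denoted by an action term. -/
def toA : ActTerm α → DAction α
  | .prim a => a
  | .comp b1 b2 => macroComp b1.toA b2.toA

/-- The mutex atoms associated with an action term
(`∅` for an ordinary action). -/
def aux : ActTerm α → Set (Mux α)
  | .prim _ => ∅
  | .comp b1 b2 => auxComp b1.toA b2.toA b2.aux

/-- Whether an action term is an ordinary (non-macro) action. -/
def IsPrim : ActTerm α → Prop
  | .prim _ => True
  | .comp _ _ => False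

/-- Well-formedness of an action term: all constituent actions are well-formed
and every composition along the term is defined. -/
def Good : ActTerm α → Prop
  | .prim a => a.WF
  | .comp b1 b2 => b1.Good ∧ b2.Good ∧ MacroDefined b1.toA b2.toA

/-- All atoms of an action term belong to `V`. -/
def OverT (V : Set α) : ActTerm α → Prop
  | .prim a => a.Over V
  | .comp b1 b2 => b1.OverT V ∧ b2.OverT V

end ActTerm

end Macro

section EffectSafe

variable {α : Type*}

/-- The extended atom type `V ∪ X`: original atoms plus mutex atoms. -/
abbrev ExtAtom (α : Type*) := α ⊕ Mux α

/-- The literals of `eff_s(a)`, encoded as mutex-atom indices: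
`(true, v)` for `v ∈ eff_s+(a)` and `(false, v)` for `v ∈ eff_s−(a)`. -/
def litStart (a : DAction α) : Set (Mux α) :=
  {m | (m.1 = true ∧ m.2 ∈ a.effSp) ∨ (m.1 = false ∧ m.2 ∈ a.effSm)}

/-- The literals of `eff_e(a)`, encoded as mutex-atom indices. -/
def litEnd (a : DAction α) : Set (Mux α) :=
  {m | (m.1 = true ∧ m.2 ∈ a.effEp) ∨ (m.1 = false ∧ m.2 ∈ a.effEm)}

/-- The effect-safe version `a#` of an action term `b`, over the extended atom
type, relative to the set `X` of all mutex atoms of the task (Definition 2). -/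
def safeA (X : Set (Mux α)) (b : ActTerm α) : DAction (ExtAtom α) where
  dur := b.toA.dur
  preS := Sum.inl '' b.toA.preS ∪ Sum.inr ''
    (b.aux ∪ {m | m ∈ X ∧ m.1 = true ∧ (false, m.2) ∈ b.aux} ∪ (X ∩ litStart b.toA))
  preInv := Sum.inl '' b.toA.preInv
  preE := Sum.inl '' b.toA.preE ∪ Sum.inr '' ((X \ b.aux) ∩ litEnd b.toA)
  effSp := Sum.inl '' b.toA.effSp
  effSm := Sum.inl '' b.toA.effSm ∪ Sum.inr '' b.aux
  effEp := Sum.inl '' b.toA.effEp ∪ Sum.inr '' b.aux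
  effEm := Sum.inl '' b.toA.effEm

/-- The set `X` of all mutex atoms of the actions in `A`. -/
def auxOf (A : Set (ActTerm α)) : Set (Mux α) := ⋃ b ∈ A, b.aux

/-- Well-formedness of a temporal planning task `(V, A, s0, g)`. -/
def TaskWF (V : Set α) (A : Set (ActTerm α)) (s0 g : Set α) : Prop :=
  V.Finite ∧ s0 ⊆ V ∧ g ⊆ V ∧ ∀ b ∈ A, b.Good ∧ b.OverT V

/-- `P` is a solution for the effect-safe task `T# = (V ∪ X, A#, s0 ∪ X, g)`
of the task `(V, A, s0, g)`: its actions belong to `A`, it is a valid plan of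
the effect-safe actions, and its induced sequence is consistent and reaches
the goal. -/
def SafeSolution (A : Set (ActTerm α)) (s0 g : Set α)
    (P : Set (ℝ × ActTerm α)) : Prop :=
  (∀ p ∈ P, p.2 ∈ A) ∧ IsPlan (safeA (auxOf A)) P ∧
  ∃ σ, InducedSeq (safeA (auxOf A)) P (Sum.inl '' s0 ∪ Sum.inr '' auxOf A) σ ∧
    Consistent (safeA (auxOf A)) P σ ∧
    Sum.inl '' g ⊆ (σ (2 * P.ncard)).2.1

/-- `P` is a solution for the original task with initial state `s0` and goal
`g`, interpreting action terms by the durative actions they denote. -/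
def OrigSolution (s0 g : Set α) (P : Set (ℝ × ActTerm α)) : Prop :=
  IsPlan ActTerm.toA P ∧
  ∃ σ, InducedSeq ActTerm.toA P s0 σ ∧ Consistent ActTerm.toA P σ ∧
    g ⊆ (σ (2 * P.ncard)).2.1

end EffectSafe

section Refine

variable {α β : Type*}

/-- The event time stamps of a plan `P`: `0` together with all starting and
ending times of its time-stamped actions. -/
def evTimes (f : β → DAction α) (P : Set (ℝ × β)) : Set ℝ :=
  insert 0 ({t | ∃ b, (t, b) ∈ P} ∪ {t | ∃ p ∈ P, p.1 + (f p.2).dur = t})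

/-- `δ_{P}(t0, a0)` for a macro-action with first-part duration `d1` and total
duration `d`: the minimum positive difference between `t0`, `t0 + d1`, `t0 + d`
and the earlier event time stamps of `P`. -/
noncomputable def delta (f : β → DAction α) (P : Set (ℝ × β)) (t0 d1 d : ℝ) : ℝ :=
  sInf {x | ∃ s ∈ evTimes f P,
    (x = t0 - s ∧ s < t0) ∨ (x = t0 + d1 - s ∧ s < t0 + d1) ∨
    (x = t0 + d - s ∧ s < t0 + d)}

/-- The plan obtained from `P'` by splitting the time-stamped macro-action
`(t0, b1 ⊕ b2)` into `(t1, b1)` and `(t2, b2)`. -/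
def splitPlan (P' : Set (ℝ × ActTerm α)) (t0 t1 t2 : ℝ) (b1 b2 : ActTerm α) :
    Set (ℝ × ActTerm α) :=
  insert (t1, b1) (insert (t2, b2) (P' \ {(t0, ActTerm.comp b1 b2)}))

/-- The side conditions of a refinement step splitting `(t0, b1 ⊕ b2) ∈ P'`
into `(t1, b1)` and `(t2, b2)`. -/
def SplitOk (P' : Set (ℝ × ActTerm α)) (t0 t1 t2 : ℝ) (b1 b2 : ActTerm α) : Prop :=
  (t0, ActTerm.comp b1 b2) ∈ P' ∧
  t0 - delta ActTerm.toA P' t0 b1.toA.dur (b1.toA.dur + b2.toA.dur) < t1 ∧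
  t1 < t0 ∧ t1 + b1.toA.dur < t2 ∧ t2 < t0 + b1.toA.dur

/-- Refined plans of (the base plan of) `P#`, obtained by iteratively
splitting time-stamped macro-actions (Definition 3). -/
inductive Refined (Ps : Set (ℝ × ActTerm α)) : Set (ℝ × ActTerm α) → Prop
  | base : Refined Ps Ps
  | step {P' : Set (ℝ × ActTerm α)} {t0 t1 t2 : ℝ} {b1 b2 : ActTerm α} :
      Refined Ps P' → SplitOk P' t0 t1 t2 b1 b2 →
      Refined Ps (splitPlan P' t0 t1 t2 b1 b2)

/-- `refine_P(v, (t1, t2))` relative to the induced sequence `σ` of `P`: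
the least time stamp before `t1` from which the atom `v` remains true up to
(just before) `t2` without being protected against by a mutex atom `x(v)` of a
macro-action in progress, or the greatest event time stamp of `P` if no such
time stamp exists. -/
noncomputable def refineT (P : Set (ℝ × ActTerm α)) (σ : ℕ → TState α)
    (v : α) (t1 t2 : ℝ) : ℝ :=
  sInf ({sSup (evTimes ActTerm.toA P)} ∪
    {τ | ∃ p ∈ P, τ = p.1 + p.2.toA.dur ∧ τ < t1 ∧ v ∈ p.2.toA.effEp ∧
      (∀ i ≤ 2 * P.ncard, τ ≤ (σ i).1 → (σ i).1 < t2 → v ∈ (σ i).2.1) ∧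
      ¬∃ q ∈ P, (true, v) ∈ q.2.aux ∧ q.1 < t2 ∧ τ < q.1 + q.2.toA.dur} ∪
    {τ | ∃ p ∈ P, τ = p.1 ∧ τ < t1 ∧ v ∈ p.2.toA.effSp ∧
      (∀ i ≤ 2 * P.ncard, τ ≤ (σ i).1 → (σ i).1 < t2 → v ∈ (σ i).2.1) ∧
      ¬∃ q ∈ P, (true, v) ∈ q.2.aux ∧ q.1 < t2 ∧ τ < q.1 + q.2.toA.dur} ∪
    {τ | τ = 0 ∧ (∀ i ≤ 2 * P.ncard, (σ i).1 < t2 → v ∈ (σ i).2.1) ∧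
      ¬∃ q ∈ P, (true, v) ∈ q.2.aux ∧ q.1 < t2})

/-- The three `refine` bounds of the induction hypothesis in the proof of
Theorem 1: for every time-stamped action of `P`, the start, invariant and end
preconditions are established early enough and protected long enough. -/
def RefineBounds (P : Set (ℝ × ActTerm α)) (σ : ℕ → TState α) : Prop :=
  ∀ p ∈ P,
    (∀ v ∈ p.2.toA.preS, refineT P σ v p.1 p.1 < p.1) ∧
    (∀ v ∈ p.2.toA.preInv, ∀ j, j < 2 * P.ncard → (σ j).1 = p.1 →
      refineT P σ v ((σ (j + 1)).1) (p.1 + p.2.toA.dur) ≤ p.1) ∧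
    (∀ v ∈ p.2.toA.preE,
      refineT P σ v (p.1 + p.2.toA.dur) (p.1 + p.2.toA.dur) < p.1 + p.2.toA.dur)

end Refine

section SplitTimes

variable {α β : Type*}

theorem ActTerm.Good.dur_pos {b : ActTerm α} (h : b.Good) : 0 < b.toA.dur := by
  induction b with
  | prim a => exact h.1
  | comp b1 b2 ih1 ih2 => exact add_pos (ih1 h.1) (ih2 h.2.1)

theorem finite_evTimes (f : β → DAction α) {P : Set (ℝ × β)} (hP : P.Finite) :
    (evTimes f P).Finite := by
  refine Set.Finite.insert _ (Set.Finite.union ?_ (hP.image fun p : ℝ × β => p.1 + (f p.2).dur))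
  refine (hP.image Prod.fst).subset ?_
  rintro t ⟨b, hb⟩
  exact ⟨(t, b), hb, rfl⟩

theorem start_mem_evTimes (f : β → DAction α) {P : Set (ℝ × β)} {p : ℝ × β} (hp : p ∈ P) :
    p.1 ∈ evTimes f P :=
  Or.inr (Or.inl ⟨p.2, hp⟩)

theorem end_mem_evTimes (f : β → DAction α) {P : Set (ℝ × β)} {p : ℝ × β} (hp : p ∈ P) :
    p.1 + (f p.2).dur ∈ evTimes f P :=
  Or.inr (Or.inr ⟨p, hp, rfl⟩)

theorem evTimes_mono (f : β → DAction α) {P Q : Set (ℝ × β)} (h : P ⊆ Q) :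
    evTimes f P ⊆ evTimes f Q := by
  rintro t (rfl | ⟨b, hb⟩ | ⟨p, hp, rfl⟩)
  · exact Or.inl rfl
  · exact start_mem_evTimes f (h hb)
  · exact end_mem_evTimes f (h hp)

theorem evTimes_insert_subset (f : β → DAction α) (P : Set (ℝ × β)) (t : ℝ) (b : β) :
    evTimes f (insert (t, b) P) ⊆ insert t (insert (t + (f b).dur) (evTimes f P)) := by
  rintro s (rfl | ⟨c, hc⟩ | ⟨p, rfl | hp, rfl⟩)
  · exact Or.inr (Or.inr (Or.inl rfl))
  · rcases hc with hc | hc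
    · exact Or.inl (congrArg Prod.fst hc)
    · exact Or.inr (Or.inr (start_mem_evTimes f hc))
  · exact Or.inr (Or.inl rfl)
  · exact Or.inr (Or.inr (end_mem_evTimes f hp))

theorem IsPlan.mono {f : β → DAction α} {P Q : Set (ℝ × β)} (hQ : IsPlan f Q) (h : P ⊆ Q) :
    IsPlan f P :=
  ⟨hQ.1.subset h, fun p hp => hQ.2.1 p (h hp),
    fun p hp q hq => hQ.2.2 p (h hp) q (h hq)⟩

/-- A plan may be extended by an action whose start and end avoid all its event time stamps. -/
theorem IsPlan.insert {f : β → DAction α} {P : Set (ℝ × β)} (hP : IsPlan f P) {t : ℝ} {b : β}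
    (ht : 0 < t) (hs : t ∉ evTimes f P) (he : t + (f b).dur ∉ evTimes f P) :
    IsPlan f (insert (t, b) P) := by
  refine ⟨hP.1.insert _, ?_, ?_⟩
  · rintro p (rfl | hp)
    exacts [ht, hP.2.1 p hp]
  · rintro p (rfl | hp) q (rfl | hq) hpq
    · exact absurd rfl hpq
    · have h1 := start_mem_evTimes f hq
      have h2 := end_mem_evTimes f hq
      exact ⟨(ne_of_mem_of_not_mem h1 hs).symm, (ne_of_mem_of_not_mem h1 he).symm,
        (ne_of_mem_of_not_mem h2 he).symm⟩
    · have h1 := start_mem_evTimes f hp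
      have h2 := end_mem_evTimes f hp
      exact ⟨ne_of_mem_of_not_mem h1 hs, ne_of_mem_of_not_mem h2 hs,
        ne_of_mem_of_not_mem h2 he⟩
    · exact hP.2.2 p hp q hq hpq

theorem delta_pos (f : β → DAction α) {P : Set (ℝ × β)} (hP : P.Finite) {t0 : ℝ}
    (ht0 : 0 < t0) (d1 d : ℝ) : 0 < delta f P t0 d1 d := by
  have hE := finite_evTimes f hP
  have hmem : delta f P t0 d1 d ∈ {x | ∃ s ∈ evTimes f P,
      (x = t0 - s ∧ s < t0) ∨ (x = t0 + d1 - s ∧ s < t0 + d1) ∨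
      (x = t0 + d - s ∧ s < t0 + d)} := by
    refine Set.Nonempty.csInf_mem ⟨t0, 0, Or.inl rfl, Or.inl ⟨by ring, ht0⟩⟩ ?_
    refine ((hE.image fun s => t0 - s).union
      ((hE.image fun s => t0 + d1 - s).union (hE.image fun s => t0 + d - s))).subset ?_
    rintro x ⟨s, hs, ⟨rfl, -⟩ | ⟨rfl, -⟩ | ⟨rfl, -⟩⟩
    exacts [Or.inl ⟨s, hs, rfl⟩, Or.inr (Or.inl ⟨s, hs, rfl⟩), Or.inr (Or.inr ⟨s, hs, rfl⟩)]
  obtain ⟨s, -, ⟨h, hlt⟩ | ⟨h, hlt⟩ | ⟨h, hlt⟩⟩ := hmem <;> linarith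

theorem delta_le_start (f : β → DAction α) (P : Set (ℝ × β)) {t0 : ℝ} (ht0 : 0 < t0)
    (d1 d : ℝ) : delta f P t0 d1 d ≤ t0 := by
  refine csInf_le ⟨0, ?_⟩ ⟨0, Or.inl rfl, Or.inl ⟨by ring, ht0⟩⟩
  rintro x ⟨s, -, ⟨rfl, h⟩ | ⟨rfl, h⟩ | ⟨rfl, h⟩⟩ <;> linarith

/-- An open interval contains a point that, like its translate by `d`, avoids a finite set. -/
theorem exists_mem_Ioo_avoiding {E : Set ℝ} (hE : E.Finite) {a b : ℝ} (hab : a < b) (d : ℝ) :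
    ∃ t ∈ Ioo a b, t ∉ E ∧ t + d ∉ E := by
  obtain ⟨t, ht, hn⟩ :=
    ((Ioo_infinite hab).sdiff (hE.union (hE.image fun s => s - d))).nonempty
  exact ⟨t, ht, fun h => hn (Or.inl h), fun h => hn (Or.inr ⟨t + d, h, by ring⟩)⟩

end SplitTimes

/-- For a plan `P'` containing a time-stamped macro-action `(t0, a1 ⊕ a2)`,
the gap `δ_{P'}(t0, a0)` is positive, and suitable splitting times `t1, t2`
exist such that the resulting set is again a valid plan. -/
theorem split_times_exist {α : Type*} (P' : Set (ℝ × ActTerm α))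
    (hP' : IsPlan ActTerm.toA P') (hGood : ∀ p ∈ P', p.2.Good)
    (t0 : ℝ) (b1 b2 : ActTerm α) (hmem : (t0, ActTerm.comp b1 b2) ∈ P') :
    0 < delta ActTerm.toA P' t0 b1.toA.dur (b1.toA.dur + b2.toA.dur) ∧
    ∃ t1 t2 : ℝ, SplitOk P' t0 t1 t2 b1 b2 ∧
      IsPlan ActTerm.toA (splitPlan P' t0 t1 t2 b1 b2) := by
  have ht0 : 0 < t0 := hP'.2.1 _ hmem
  have hgood := hGood _ hmem
  have hd1 := ActTerm.Good.dur_pos hgood.1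
  have hd2 := ActTerm.Good.dur_pos hgood.2.1
  have hE := finite_evTimes ActTerm.toA hP'.1
  have hδ := delta_pos ActTerm.toA hP'.1 ht0 b1.toA.dur (b1.toA.dur + b2.toA.dur)
  have hδ' := delta_le_start ActTerm.toA P' ht0 b1.toA.dur (b1.toA.dur + b2.toA.dur)
  refine ⟨hδ, ?_⟩
  obtain ⟨t1, ⟨h1, h1'⟩, hs1, he1⟩ := exists_mem_Ioo_avoiding hE (sub_lt_self t0 hδ) b1.toA.dur
  obtain ⟨t2, ⟨h2, h2'⟩, hs2, he2⟩ :=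
    exists_mem_Ioo_avoiding hE (add_lt_add_left h1' b1.toA.dur) b2.toA.dur
  refine ⟨t1, t2, ⟨hmem, h1, h1', h2, h2'⟩, ?_⟩
  have hsub := evTimes_mono ActTerm.toA (sdiff_subset (s := P') (t := {(t0, ActTerm.comp b1 b2)}))
  refine IsPlan.insert ((hP'.mono sdiff_subset).insert (by linarith) (fun h => hs2 (hsub h))
    fun h => he2 (hsub h)) (by linarith) (fun h => ?_) fun h => ?_
  · rcases evTimes_insert_subset _ _ _ _ h with h | h | h
    exacts [by linarith, by linarith, hs1 (hsub h)]
  · rcases evTimes_insert_subset _ _ _ _ h with h | h | h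
    exacts [by linarith, by linarith, he1 (hsub h)]
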